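/- arXiv:1305.1389 — 9 statements merged into one kernel-verified Lean document; each statement's English description precedes it below -/
import Mathlib

section
/- There exist a dendriform dialgebra D over the rational numbers and elements a, b, c ∈ D such that the span of the 12 elements [x_{σ(1)}, x_{σ(2)}, x_{σ(3)}]_i, where (x_1, x_2, x_3) = (a, b, c), σ ranges over the 6 permutations of {1,2,3}, and i ∈ {1,2}, has dimension 9; thus every multilinear identity of degree 3 satisfied by the pre-Lie triple products in all dendriform dialgebras follows from the three permutations of the ternary right-symmetric identity [a,b,c]_1 − [a,c,b]_1 − [a,b,c]_2 + [a,c,b]_2 = 0. -/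
/-- A dendriform dialgebra over a field `F`: a vector space with two bilinear
operations `≺` (`prec`) and `≻` (`succ`) satisfying the dendriform axioms. -/
structure DendriformDialgebra (F : Type*) [Field F] where
  carrier : Type*
  [addCommGroup : AddCommGroup carrier]
  [module : Module F carrier]
  prec : carrier →ₗ[F] carrier →ₗ[F] carrier
  succ : carrier →ₗ[F] carrier →ₗ[F] carrier
  prec_prec : ∀ x y z, prec (prec x y) z = prec x (prec y z) + prec x (succ y z)
  inner_assoc : ∀ x y z, prec (succ x y) z = succ x (prec y z)
  succ_succ : ∀ x y z, succ x (succ y z) = succ (succ x y) z + succ (prec x y) z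

attribute [instance] DendriformDialgebra.addCommGroup DendriformDialgebra.module

namespace DendriformDialgebra

variable {F : Type*} [Field F] (A : DendriformDialgebra F)

/-- The pre-Lie product `a · b = a ≺ b − b ≻ a`. -/
def preLie (x y : A.carrier) : A.carrier := A.prec x y - A.succ y x

/-- The first pre-Lie triple product `[a,b,c]₁ = (a · b) · c`. -/
def plt1 (x y z : A.carrier) : A.carrier := A.preLie (A.preLie x y) z

/-- The second pre-Lie triple product `[a,b,c]₂ = a · (b · c)`. -/
def plt2 (x y z : A.carrier) : A.carrier := A.preLie x (A.preLie y z)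

/-- The pre-Jordan product `a · b = a ≻ b + b ≺ a`. -/
def preJordan (x y : A.carrier) : A.carrier := A.succ x y + A.prec y x

/-- The first pre-Jordan triple product `⟨a,b,c⟩₁ = (a · b) · c`. -/
def pjt1 (x y z : A.carrier) : A.carrier := A.preJordan (A.preJordan x y) z

/-- The second pre-Jordan triple product `⟨a,b,c⟩₂ = a · (b · c)`. -/
def pjt2 (x y z : A.carrier) : A.carrier := A.preJordan x (A.preJordan y z)

end DendriformDialgebra

open DendriformDialgebra

universe u
set_option linter.unusedSimpArgs false

namespace DendriformDialgebra

abbrev Mat2 := Matrix (Fin 2) (Fin 2) ℚ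

/-- Triples of matrices, in an arbitrary universe. -/
abbrev Car : Type u := ULift.{u} (Mat2 × Mat2 × Mat2)

/-- `x ≺ y = x * T(y)` with `T` the inclusive partial sums. -/
def precFun (x y : Car.{u}) : Car.{u} :=
  ⟨(x.down.1 * y.down.1, x.down.2.1 * (y.down.1 + y.down.2.1),
    x.down.2.2 * (y.down.1 + y.down.2.1 + y.down.2.2))⟩

/-- `x ≻ y = S(x) * y` with `S` the strict partial sums. -/
def succFun (x y : Car.{u}) : Car.{u} :=
  ⟨(0, x.down.1 * y.down.2.1, (x.down.1 + x.down.2.1) * y.down.2.2)⟩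

theorem car_ext {x y : Car.{u}} (h1 : x.down.1 = y.down.1) (h2 : x.down.2.1 = y.down.2.1)
    (h3 : x.down.2.2 = y.down.2.2) : x = y :=
  ULift.ext _ _ (Prod.ext h1 (Prod.ext h2 h3))

def seqAlg : DendriformDialgebra.{0, u} ℚ where
  carrier := Car.{u}
  prec := LinearMap.mk₂ ℚ precFun
    (by intros; apply car_ext <;> simp [precFun] <;> noncomm_ring)
    (by intros; apply car_ext <;> simp [precFun])
    (by intros; apply car_ext <;> simp [precFun] <;> noncomm_ring)
    (by intros; apply car_ext <;> simp [precFun, ← smul_add])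
  succ := LinearMap.mk₂ ℚ succFun
    (by intros; apply car_ext <;> simp [succFun] <;> noncomm_ring)
    (by intros; apply car_ext <;> simp [succFun, ← smul_add])
    (by intros; apply car_ext <;> simp [succFun] <;> noncomm_ring)
    (by intros; apply car_ext <;> simp [succFun])
  prec_prec := by
    intro x y z; apply car_ext <;> simp [precFun, succFun] <;> noncomm_ring
  inner_assoc := by
    intro x y z; apply car_ext <;> simp [precFun, succFun] <;> noncomm_ring
  succ_succ := by
    intro x y z; apply car_ext <;> simp [precFun, succFun] <;> noncomm_ring

/-- The right-symmetric identity. -/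
theorem plt2_swap {F : Type*} [Field F] (A : DendriformDialgebra F) (x y z : A.carrier) :
    A.plt2 x z y = A.plt1 x z y - A.plt1 x y z + A.plt2 x y z := by
  simp only [plt1, plt2, preLie, map_sub, LinearMap.sub_apply, A.prec_prec, A.inner_assoc,
    A.succ_succ]
  abel

def plFun (x y : Car.{u}) : Car.{u} := precFun x y - succFun y x

theorem plt1_seqAlg (x y z : Car.{u}) :
    seqAlg.{u}.plt1 x y z = plFun (plFun x y) z := rfl

theorem plt2_seqAlg (x y z : Car.{u}) :
    seqAlg.{u}.plt2 x y z = plFun x (plFun y z) := rfl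

def ea : Car.{u} := ⟨(!![0, 1; 1, 0], !![0, 0; 0, 0], !![0, 0; 0, 1])⟩

def eb : Car.{u} := ⟨(!![0, 1; 0, 0], !![0, 0; 0, 1], !![0, 0; 0, 0])⟩

def ec : Car.{u} := ⟨(!![0, 0; 0, 1], !![1, 0; 1, 0], !![0, 0; 0, 0])⟩

theorem pl_ab : plFun ea.{u} eb = ⟨(!![0, 0; 0, 1], !![0, 0; 0, 0], !![0, -1; 0, 0])⟩ := by
  apply car_ext <;> ext i j <;> fin_cases i <;> fin_cases j <;>
    norm_num [plFun, precFun, succFun, ea, eb, ec, Matrix.mul_apply]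

theorem pl_ac : plFun ea.{u} ec = ⟨(!![0, 1; 0, 0], !![0, 0; 0, 0], !![0, 0; 1, 0])⟩ := by
  apply car_ext <;> ext i j <;> fin_cases i <;> fin_cases j <;>
    norm_num [plFun, precFun, succFun, ea, eb, ec, Matrix.mul_apply]

theorem pl_ba : plFun eb.{u} ea = ⟨(!![1, 0; 0, 0], !![0, -1; 1, 0], !![0, 0; 0, 0])⟩ := by
  apply car_ext <;> ext i j <;> fin_cases i <;> fin_cases j <;>
    norm_num [plFun, precFun, succFun, ea, eb, ec, Matrix.mul_apply]

theorem pl_bc : plFun eb.{u} ec = ⟨(!![0, 1; 0, 0], !![0, 0; 1, 0], !![0, 0; 0, 0])⟩ := by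
  apply car_ext <;> ext i j <;> fin_cases i <;> fin_cases j <;>
    norm_num [plFun, precFun, succFun, ea, eb, ec, Matrix.mul_apply]

theorem pl_ca : plFun ec.{u} ea = ⟨(!![0, 0; 1, 0], !![-1, 1; -1, 1], !![0, 0; 0, 0])⟩ := by
  apply car_ext <;> ext i j <;> fin_cases i <;> fin_cases j <;>
    norm_num [plFun, precFun, succFun, ea, eb, ec, Matrix.mul_apply]

theorem pl_cb : plFun ec.{u} eb = ⟨(!![0, 0; 0, 0], !![-1, 1; 0, 1], !![0, 0; 0, 0])⟩ := by
  apply car_ext <;> ext i j <;> fin_cases i <;> fin_cases j <;>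
    norm_num [plFun, precFun, succFun, ea, eb, ec, Matrix.mul_apply]

theorem val1_abc : seqAlg.{u}.plt1 ea eb ec =
    (⟨(!![0, 0; 0, 1], !![0, 0; 0, 0], !![-1, 0; 0, 1])⟩ : Car.{u}) := by
  rw [plt1_seqAlg, pl_ab]
  apply car_ext <;> ext i j <;> fin_cases i <;> fin_cases j <;>
    norm_num [plFun, precFun, succFun, ea, eb, ec, Matrix.mul_apply]

theorem val1_acb : seqAlg.{u}.plt1 ea ec eb =
    (⟨(!![0, 0; 0, 0], !![0, 0; 0, 0], !![-1, 0; -1, 1])⟩ : Car.{u}) := by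
  rw [plt1_seqAlg, pl_ac]
  apply car_ext <;> ext i j <;> fin_cases i <;> fin_cases j <;>
    norm_num [plFun, precFun, succFun, ea, eb, ec, Matrix.mul_apply]

theorem val1_bac : seqAlg.{u}.plt1 eb ea ec =
    (⟨(!![0, 0; 0, 0], !![-1, -1; 0, 0], !![0, 0; 0, 0])⟩ : Car.{u}) := by
  rw [plt1_seqAlg, pl_ba]
  apply car_ext <;> ext i j <;> fin_cases i <;> fin_cases j <;>
    norm_num [plFun, precFun, succFun, ea, eb, ec, Matrix.mul_apply]

theorem val1_bca : seqAlg.{u}.plt1 eb ec ea =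
    (⟨(!![1, 0; 0, 0], !![-1, 0; 0, 1], !![0, 0; 0, 0])⟩ : Car.{u}) := by
  rw [plt1_seqAlg, pl_bc]
  apply car_ext <;> ext i j <;> fin_cases i <;> fin_cases j <;>
    norm_num [plFun, precFun, succFun, ea, eb, ec, Matrix.mul_apply]

theorem val1_cab : seqAlg.{u}.plt1 ec ea eb =
    (⟨(!![0, 0; 0, 1], !![1, -1; 0, 0], !![0, 0; 0, 0])⟩ : Car.{u}) := by
  rw [plt1_seqAlg, pl_ca]
  apply car_ext <;> ext i j <;> fin_cases i <;> fin_cases j <;>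
    norm_num [plFun, precFun, succFun, ea, eb, ec, Matrix.mul_apply]

theorem val1_cba : seqAlg.{u}.plt1 ec eb ea =
    (⟨(!![0, 0; 0, 0], !![1, -2; 2, -1], !![0, 0; 0, 0])⟩ : Car.{u}) := by
  rw [plt1_seqAlg, pl_cb]
  apply car_ext <;> ext i j <;> fin_cases i <;> fin_cases j <;>
    norm_num [plFun, precFun, succFun, ea, eb, ec, Matrix.mul_apply]

theorem val2_abc : seqAlg.{u}.plt2 ea eb ec =
    (⟨(!![0, 0; 0, 1], !![0, 0; 0, 0], !![0, -1; 1, 0])⟩ : Car.{u}) := by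
  rw [plt2_seqAlg, pl_bc]
  apply car_ext <;> ext i j <;> fin_cases i <;> fin_cases j <;>
    norm_num [plFun, precFun, succFun, ea, eb, ec, Matrix.mul_apply]

theorem val2_bac : seqAlg.{u}.plt2 eb ea ec =
    (⟨(!![0, 0; 0, 0], !![0, -1; 0, 0], !![0, 0; 0, 0])⟩ : Car.{u}) := by
  rw [plt2_seqAlg, pl_ac]
  apply car_ext <;> ext i j <;> fin_cases i <;> fin_cases j <;>
    norm_num [plFun, precFun, succFun, ea, eb, ec, Matrix.mul_apply]

theorem val2_cab : seqAlg.{u}.plt2 ec ea eb =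
    (⟨(!![0, 0; 0, 1], !![0, 0; -1, 0], !![0, 0; 0, 0])⟩ : Car.{u}) := by
  rw [plt2_seqAlg, pl_ab]
  apply car_ext <;> ext i j <;> fin_cases i <;> fin_cases j <;>
    norm_num [plFun, precFun, succFun, ea, eb, ec, Matrix.mul_apply]

/-- The nine chosen products. -/
def nine {F : Type*} [Field F] (A : DendriformDialgebra F) (a b c : A.carrier) :
    Fin 9 → A.carrier :=
  ![A.plt1 a b c, A.plt1 a c b, A.plt1 b a c, A.plt1 b c a, A.plt1 c a b, A.plt1 c b a, A.plt2 a b c, A.plt2 b a c, A.plt2 c a b]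

def nineVec : Fin 9 → Car.{u} :=
  ![⟨(!![0, 0; 0, 1], !![0, 0; 0, 0], !![-1, 0; 0, 1])⟩,
    ⟨(!![0, 0; 0, 0], !![0, 0; 0, 0], !![-1, 0; -1, 1])⟩,
    ⟨(!![0, 0; 0, 0], !![-1, -1; 0, 0], !![0, 0; 0, 0])⟩,
    ⟨(!![1, 0; 0, 0], !![-1, 0; 0, 1], !![0, 0; 0, 0])⟩,
    ⟨(!![0, 0; 0, 1], !![1, -1; 0, 0], !![0, 0; 0, 0])⟩,
    ⟨(!![0, 0; 0, 0], !![1, -2; 2, -1], !![0, 0; 0, 0])⟩,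
    ⟨(!![0, 0; 0, 1], !![0, 0; 0, 0], !![0, -1; 1, 0])⟩,
    ⟨(!![0, 0; 0, 0], !![0, -1; 0, 0], !![0, 0; 0, 0])⟩,
    ⟨(!![0, 0; 0, 1], !![0, 0; -1, 0], !![0, 0; 0, 0])⟩]

theorem nine_eq : nine seqAlg.{u} ea eb ec = nineVec.{u} := by
  simp only [nine, val1_abc, val1_acb, val1_bac, val1_bca, val1_cab, val1_cba, val2_abc, val2_bac, val2_cab]
  rfl

theorem nineVec_indep : LinearIndependent ℚ nineVec.{u} := by
  rw [Fintype.linearIndependent_iff]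
  intro g hg
  rw [Fin.sum_univ_succ, Fin.sum_univ_eight] at hg
  simp only [nineVec] at hg
  have k : ∀ (f : Car.{u} → ℚ), f _ = f 0 := fun f => congrArg f hg
  have h0 := k (fun x => x.down.1 0 0)
  have h3 := k (fun x => x.down.1 1 1)
  have h4 := k (fun x => x.down.2.1 0 0)
  have h5 := k (fun x => x.down.2.1 0 1)
  have h6 := k (fun x => x.down.2.1 1 0)
  have h7 := k (fun x => x.down.2.1 1 1)
  have h8 := k (fun x => x.down.2.2 0 0)
  have h9 := k (fun x => x.down.2.2 0 1)
  have h10 := k (fun x => x.down.2.2 1 0)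
  have h11 := k (fun x => x.down.2.2 1 1)
  clear k hg
  simp [Fin.succ] at h0 h3 h4 h5 h6 h7 h8 h9 h10 h11
  intro i
  fin_cases i <;> simp <;> linarith

theorem nine_indep : LinearIndependent ℚ (nine seqAlg.{u} ea eb ec) := by
  rw [nine_eq]
  exact nineVec_indep

theorem span_twelve {V : Type*} [AddCommGroup V] [Module ℚ V]
    (p1 p2 p3 p4 p5 p6 q1 q2 q3 q4 q5 q6 : V)
    (h2 : q2 = p2 - p1 + q1) (h4 : q4 = p4 - p3 + q3) (h6 : q6 = p6 - p5 + q5) :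
    Submodule.span ℚ (Set.range ![p1, p2, p3, p4, p5, p6, q1, q2, q3, q4, q5, q6]) =
      Submodule.span ℚ (Set.range ![p1, p2, p3, p4, p5, p6, q1, q3, q5]) := by
  simp only [Matrix.range_cons, Matrix.range_empty, Set.union_empty, Set.singleton_union]
  apply le_antisymm
  · generalize hT : Submodule.span ℚ {p1, p2, p3, p4, p5, p6, q1, q3, q5} = T
    have hs : ({p1, p2, p3, p4, p5, p6, q1, q3, q5} : Set V) ⊆ T := hT ▸ Submodule.subset_span
    simp only [Set.insert_subset_iff, Set.singleton_subset_iff, SetLike.mem_coe] at hs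
    obtain ⟨m1, m2, m3, m4, m5, m6, n1, n3, n5⟩ := hs
    rw [Submodule.span_le]
    simp only [Set.insert_subset_iff, Set.singleton_subset_iff, SetLike.mem_coe]
    refine ⟨m1, m2, m3, m4, m5, m6, n1, ?_, n3, ?_, n5, ?_⟩
    · exact h2 ▸ add_mem (sub_mem m2 m1) n1
    · exact h4 ▸ add_mem (sub_mem m4 m3) n3
    · exact h6 ▸ add_mem (sub_mem m6 m5) n5
  · apply Submodule.span_mono
    intro x
    simp only [Set.mem_insert_iff, Set.mem_singleton_iff]
    tauto

theorem finrank_nine (A : DendriformDialgebra ℚ) (a b c : A.carrier)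
    (h : LinearIndependent ℚ (nine A a b c)) :
    Module.finrank ℚ (Submodule.span ℚ (Set.range
      (![A.plt1 a b c, A.plt1 a c b, A.plt1 b a c, A.plt1 b c a, A.plt1 c a b, A.plt1 c b a, A.plt2 a b c, A.plt2 a c b, A.plt2 b a c, A.plt2 b c a, A.plt2 c a b, A.plt2 c b a] : Fin 12 → A.carrier))) = 9 := by
  rw [span_twelve _ _ _ _ _ _ _ _ _ _ _ _ (plt2_swap A _ _ _) (plt2_swap A _ _ _)
      (plt2_swap A _ _ _)]
  exact (finrank_span_eq_card h).trans (by simp)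

end DendriformDialgebra

open DendriformDialgebra

theorem preLie_triple_degree3_span_dim_nine :
    ∃ (A : DendriformDialgebra ℚ) (a b c : A.carrier),
      Module.finrank ℚ
        (Submodule.span ℚ (Set.range (![A.plt1 a b c, A.plt1 a c b, A.plt1 b a c, A.plt1 b c a, A.plt1 c a b, A.plt1 c b a, A.plt2 a b c, A.plt2 a c b, A.plt2 b a c, A.plt2 b c a, A.plt2 c a b, A.plt2 c b a] : Fin 12 → A.carrier))) = 9 := by
  exact ⟨seqAlg, ea, eb, ec, finrank_nine _ _ _ _ nine_indep⟩
end

section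
/- There exist a dendriform dialgebra D over the rational numbers and elements a, b, c ∈ D such that the 12 elements ⟨x_{σ(1)}, x_{σ(2)}, x_{σ(3)}⟩_i, where (x_1, x_2, x_3) = (a, b, c), σ ranges over the 6 permutations of {1,2,3}, and i ∈ {1,2}, are linearly independent; thus the pre-Jordan triple products satisfy no multilinear polynomial identities of degree 3 in all dendriform dialgebras. -/
namespace PJFree

universe u

/-- Basis of the free dendriform dialgebra on three generators, truncated above degree 3. -/
inductive Idx : Type u
  | v (i : Fin 3)
  | p (i j : Fin 3)
  | s (i j : Fin 3)
  | t1 (i j k : Fin 3)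
  | t2 (i j k : Fin 3)
  | t3 (i j k : Fin 3)
  | t4 (i j k : Fin 3)
  | t5 (i j k : Fin 3)

open Idx

def precF (x y : Idx.{u} → ℚ) : Idx.{u} → ℚ
  | v _ => 0
  | p i j => x (v i) * y (v j)
  | s _ _ => 0
  | t1 _ _ _ => 0
  | t2 _ _ _ => 0
  | t3 i j k => x (s i j) * y (v k)
  | t4 i j k => x (v i) * y (p j k) + x (p i j) * y (v k)
  | t5 i j k => x (v i) * y (s j k) + x (p i j) * y (v k)

def succF (x y : Idx.{u} → ℚ) : Idx.{u} → ℚ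
  | v _ => 0
  | p _ _ => 0
  | s i j => x (v i) * y (v j)
  | t1 i j k => x (v i) * y (s j k) + x (s i j) * y (v k)
  | t2 i j k => x (v i) * y (s j k) + x (p i j) * y (v k)
  | t3 i j k => x (v i) * y (p j k)
  | t4 _ _ _ => 0
  | t5 _ _ _ => 0

def alg : DendriformDialgebra.{0, u} ℚ where
  carrier := Idx.{u} → ℚ
  prec := LinearMap.mk₂ ℚ precF
    (by intro x y z; ext i; cases i <;> simp [precF] <;> ring)
    (by intro x y z; ext i; cases i <;> simp [precF] <;> ring)
    (by intro x y z; ext i; cases i <;> simp [precF] <;> ring)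
    (by intro x y z; ext i; cases i <;> simp [precF] <;> ring)
  succ := LinearMap.mk₂ ℚ succF
    (by intro x y z; ext i; cases i <;> simp [succF] <;> ring)
    (by intro x y z; ext i; cases i <;> simp [succF] <;> ring)
    (by intro x y z; ext i; cases i <;> simp [succF] <;> ring)
    (by intro x y z; ext i; cases i <;> simp [succF] <;> ring)
  prec_prec := by
    intro x y z; ext i; cases i <;> simp [precF, succF] <;> ring
  inner_assoc := by
    intro x y z; ext i; cases i <;> simp [precF, succF] <;> ring
  succ_succ := by
    intro x y z; ext i; cases i <;> simp [precF, succF] <;> ring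

def gen (n : Fin 3) : Idx.{u} → ℚ
  | v i => if i = n then 1 else 0
  | _ => 0

def P1 (x y z : Idx.{u} → ℚ) : Idx.{u} → ℚ :=
  succF (succF x y + precF y x) z + precF z (succF x y + precF y x)

def P2 (x y z : Idx.{u} → ℚ) : Idx.{u} → ℚ :=
  succF x (succF y z + precF z y) + precF (succF y z + precF z y) x

theorem indep (g : Fin 12 → ℚ)
    (h : ∑ i, g i • (![P1 (gen 0) (gen 1) (gen 2), P1 (gen 0) (gen 2) (gen 1),
      P1 (gen 1) (gen 0) (gen 2), P1 (gen 1) (gen 2) (gen 0),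
      P1 (gen 2) (gen 0) (gen 1), P1 (gen 2) (gen 1) (gen 0),
      P2 (gen 0) (gen 1) (gen 2), P2 (gen 0) (gen 2) (gen 1),
      P2 (gen 1) (gen 0) (gen 2), P2 (gen 1) (gen 2) (gen 0),
      P2 (gen 2) (gen 0) (gen 1), P2 (gen 2) (gen 1) (gen 0)] :
        Fin 12 → (Idx.{u} → ℚ)) i = 0) (i : Fin 12) : g i = 0 := by
  simp only [Fin.sum_univ_succ, Fin.sum_univ_zero] at h
  have e1 (i j k : Fin 3) := congrFun h (t1 i j k)
  have e2 (i j k : Fin 3) := congrFun h (t2 i j k)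
  have e3 (i j k : Fin 3) := congrFun h (t3 i j k)
  clear h
  have a1 := e1 0 1 2
  have a2 := e1 0 2 1
  have a3 := e1 1 0 2
  have a4 := e1 1 2 0
  have a5 := e1 2 0 1
  have a6 := e1 2 1 0
  have b1 := e2 0 1 2
  have b2 := e2 0 2 1
  have b3 := e2 1 0 2
  have b4 := e2 1 2 0
  have b5 := e2 2 0 1
  have b6 := e2 2 1 0
  have c1 := e3 0 1 2
  have c2 := e3 0 2 1
  have c3 := e3 1 0 2
  have c4 := e3 1 2 0
  have c5 := e3 2 0 1
  have c6 := e3 2 1 0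
  clear e1 e2 e3
  simp [P1, P2, succF, precF, gen] at a1 a2 a3 a4 a5 a6 b1 b2 b3 b4 b5 b6 c1 c2 c3 c4 c5 c6
  fin_cases i <;> simp <;> linarith

end PJFree

open DendriformDialgebra

theorem preJordan_triple_degree3_independent :
    ∃ (A : DendriformDialgebra ℚ) (a b c : A.carrier),
      LinearIndependent ℚ (![A.pjt1 a b c, A.pjt1 a c b, A.pjt1 b a c, A.pjt1 b c a, A.pjt1 c a b, A.pjt1 c b a, A.pjt2 a b c, A.pjt2 a c b, A.pjt2 b a c, A.pjt2 b c a, A.pjt2 c a b, A.pjt2 c b a] : Fin 12 → A.carrier) := by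
  refine ⟨PJFree.alg, PJFree.gen 0, PJFree.gen 1, PJFree.gen 2, ?_⟩
  rw [Fintype.linearIndependent_iff]
  exact PJFree.indep
end

section
/- In every dendriform dialgebra D over a field of characteristic 0, the pre-Lie triple products satisfy the following multilinear identity of degree 5: for all a, b, c, d, e ∈ D, [[a,b,c]_1, d, e]_2 − [[a,d,e]_2, b, c]_1 + [a, [d,e,b]_1, c]_1 − [a, [b,d,e]_2, c]_1 + [a, b, [d,e,c]_1]_1 − [a, b, [c,d,e]_2]_1 = 0. -/
open DendriformDialgebra

/-- The product `preLie` is right-symmetric. -/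
theorem preLie_right_symm_aux {F : Type*} [Field F] (A : DendriformDialgebra F)
    (x y z : A.carrier) :
    A.preLie (A.preLie x y) z
      = A.preLie (A.preLie x z) y + A.preLie x (A.preLie y z) - A.preLie x (A.preLie z y) := by
  simp only [DendriformDialgebra.preLie, map_sub, LinearMap.sub_apply, A.prec_prec,
    A.inner_assoc, A.succ_succ]
  abel

theorem preLie_sub_left_aux {F : Type*} [Field F] (A : DendriformDialgebra F)
    (x y z : A.carrier) :
    A.preLie (x - y) z = A.preLie x z - A.preLie y z := by
  simp only [DendriformDialgebra.preLie, map_sub, LinearMap.sub_apply]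
  abel

theorem preLie_add_left_aux {F : Type*} [Field F] (A : DendriformDialgebra F)
    (x y z : A.carrier) :
    A.preLie (x + y) z = A.preLie x z + A.preLie y z := by
  simp only [DendriformDialgebra.preLie, map_add, LinearMap.add_apply]
  abel

theorem preLie_triple_identity_degree5_first
    {F : Type*} [Field F] [CharZero F] (A : DendriformDialgebra F)
    (a b c d e : A.carrier) :
    A.plt2 (A.plt1 a b c) d e - A.plt1 (A.plt2 a d e) b c
      + A.plt1 a (A.plt1 d e b) c - A.plt1 a (A.plt2 b d e) c
      + A.plt1 a b (A.plt1 d e c) - A.plt1 a b (A.plt2 c d e) = 0 := by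
  simp only [DendriformDialgebra.plt1, DendriformDialgebra.plt2]
  rw [preLie_right_symm_aux A (A.preLie a b) c (A.preLie d e),
    preLie_right_symm_aux A a b (A.preLie d e), preLie_sub_left_aux, preLie_add_left_aux]
  abel
end

section
/- In every dendriform dialgebra D over a field of characteristic 0, the pre-Lie triple products satisfy the following multilinear identity of degree 5: for all a, b, c, d, e ∈ D, [[a,b,c]_1, d, e]_2 − [[a,d,e]_2, b, c]_1 + [[a,d,e]_2, b, c]_2 − [[a,b,c]_2, d, e]_2 + [a, [d,e,b]_1, c]_1 + [a, [d,e,c]_1, b]_1 − [a, [b,c,e]_1, d]_1 − [a, [d,e,c]_1, b]_2 + [a, [b,c,e]_1, d]_2 − [a, [b,d,e]_2, c]_1 − [a, [c,d,e]_2, b]_1 − [a, [d,b,c]_2, e]_2 + [a, [b,d,e]_2, c]_2 + [a, [c,d,e]_2, b]_2 + [a, d, [b,c,e]_1]_1 − [a, d, [e,b,c]_2]_2 = 0. -/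
open DendriformDialgebra

set_option maxHeartbeats 4000000 in
set_option maxRecDepth 100000 in
theorem preLie_triple_identity_degree5_third
    {F : Type*} [Field F] [CharZero F] (A : DendriformDialgebra F)
    (a b c d e : A.carrier) :
    A.plt2 (A.plt1 a b c) d e - A.plt1 (A.plt2 a d e) b c
      + A.plt2 (A.plt2 a d e) b c - A.plt2 (A.plt2 a b c) d e
      + A.plt1 a (A.plt1 d e b) c + A.plt1 a (A.plt1 d e c) b
      - A.plt1 a (A.plt1 b c e) d - A.plt2 a (A.plt1 d e c) b
      + A.plt2 a (A.plt1 b c e) d - A.plt1 a (A.plt2 b d e) c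
      - A.plt1 a (A.plt2 c d e) b - A.plt2 a (A.plt2 d b c) e
      + A.plt2 a (A.plt2 b d e) c + A.plt2 a (A.plt2 c d e) b
      + A.plt1 a d (A.plt1 b c e) - A.plt2 a d (A.plt2 e b c) = 0 := by
  simp only [plt1, plt2, preLie, map_sub, map_add, LinearMap.sub_apply, LinearMap.add_apply,
    A.prec_prec, A.inner_assoc, A.succ_succ]
  abel
end

section
/- In every dendriform dialgebra D over a field of characteristic 0, the pre-Jordan triple products satisfy the identity PJTS_1 = 0: for all a, b, c, d, e ∈ D, ⟨⟨a,b,c⟩_1, d, e⟩_1 + ⟨⟨b,a,c⟩_1, d, e⟩_1 + ⟨⟨c,a,b⟩_2, d, e⟩_1 + ⟨⟨c,b,a⟩_2, d, e⟩_1 − ⟨a, ⟨b,c,d⟩_1, e⟩_1 − ⟨a, ⟨c,b,d⟩_1, e⟩_1 − ⟨b, ⟨a,c,d⟩_1, e⟩_1 − ⟨b, ⟨c,a,d⟩_1, e⟩_1 − ⟨c, ⟨a,b,d⟩_1, e⟩_1 − ⟨c, ⟨b,a,d⟩_1, e⟩_1 + ⟨a, ⟨c,b,d⟩_2, e⟩_1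 + ⟨b, ⟨c,a,d⟩_2, e⟩_1 = 0. -/
open DendriformDialgebra

theorem preJordan_deg4 {F : Type*} [Field F] (A : DendriformDialgebra F)
    (a b c d : A.carrier) :
    A.pjt1 (A.preJordan a b) c d + A.pjt1 (A.preJordan b a) c d
      + A.preJordan (A.pjt2 c a b) d + A.preJordan (A.pjt2 c b a) d
      - A.preJordan a (A.pjt1 b c d) - A.preJordan a (A.pjt1 c b d)
      - A.preJordan b (A.pjt1 a c d) - A.preJordan b (A.pjt1 c a d)
      - A.preJordan c (A.pjt1 a b d) - A.preJordan c (A.pjt1 b a d)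
      + A.preJordan a (A.pjt2 c b d) + A.preJordan b (A.pjt2 c a d) = 0 := by
  simp only [pjt1, pjt2, preJordan, map_add, LinearMap.add_apply, A.prec_prec, A.inner_assoc,
    A.succ_succ]
  abel

theorem preJordan_triple_PJTS1
    {F : Type*} [Field F] [CharZero F] (A : DendriformDialgebra F)
    (a b c d e : A.carrier) :
    A.pjt1 (A.pjt1 a b c) d e + A.pjt1 (A.pjt1 b a c) d e
      + A.pjt1 (A.pjt2 c a b) d e + A.pjt1 (A.pjt2 c b a) d e
      - A.pjt1 a (A.pjt1 b c d) e - A.pjt1 a (A.pjt1 c b d) e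
      - A.pjt1 b (A.pjt1 a c d) e - A.pjt1 b (A.pjt1 c a d) e
      - A.pjt1 c (A.pjt1 a b d) e - A.pjt1 c (A.pjt1 b a d) e
      + A.pjt1 a (A.pjt2 c b d) e + A.pjt1 b (A.pjt2 c a d) e = 0 := by
  have h := congrArg (fun z => A.preJordan z e) (preJordan_deg4 A a b c d)
  simp only [pjt1, pjt2, preJordan, map_add, map_sub, map_zero, LinearMap.add_apply,
    LinearMap.sub_apply, LinearMap.zero_apply, add_zero] at h ⊢
  rw [← h]
  abel
end

section
/- In every dendriform dialgebra D over a field of characteristic 0, the pre-Jordan triple products satisfy the identity PJTS_2 = 0: for all a, b, c, d, e ∈ D, ⟨⟨b,d,a⟩_1, c, e⟩_2 + ⟨⟨b,d,c⟩_1, a, e⟩_2 + ⟨⟨a,b,d⟩_2, c, e⟩_2 + ⟨⟨c,b,d⟩_2, a, e⟩_2 − ⟨a, ⟨b,d,c⟩_1, e⟩_2 − ⟨c, ⟨b,d,a⟩_1, e⟩_2 − ⟨a, ⟨c,b,d⟩_2, e⟩_2 − ⟨c, ⟨a,b,d⟩_2, e⟩_2 + ⟨a, c, ⟨b,d,e⟩_1⟩_1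 − ⟨b, d, ⟨a,c,e⟩_1⟩_1 − ⟨b, d, ⟨c,a,e⟩_1⟩_1 + ⟨c, a, ⟨b,d,e⟩_1⟩_1 = 0. -/
open DendriformDialgebra

set_option maxHeartbeats 4000000 in
theorem preJordan_triple_PJTS2
    {F : Type*} [Field F] [CharZero F] (A : DendriformDialgebra F)
    (a b c d e : A.carrier) :
    A.pjt2 (A.pjt1 b d a) c e + A.pjt2 (A.pjt1 b d c) a e
      + A.pjt2 (A.pjt2 a b d) c e + A.pjt2 (A.pjt2 c b d) a e
      - A.pjt2 a (A.pjt1 b d c) e - A.pjt2 c (A.pjt1 b d a) e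
      - A.pjt2 a (A.pjt2 c b d) e - A.pjt2 c (A.pjt2 a b d) e
      + A.pjt1 a c (A.pjt1 b d e) - A.pjt1 b d (A.pjt1 a c e)
      - A.pjt1 b d (A.pjt1 c a e) + A.pjt1 c a (A.pjt1 b d e) = 0 := by
  simp only [pjt1, pjt2, preJordan, map_add, LinearMap.add_apply, A.prec_prec, A.inner_assoc,
    A.succ_succ]
  abel
end

section
/- In every dendriform dialgebra D over a field of characteristic 0, the pre-Jordan triple products satisfy the identity PJTS_3 = 0: for all a, b, c, d, e ∈ D, ⟨⟨b,c,d⟩_1, a, e⟩_1 + ⟨⟨d,b,c⟩_2, a, e⟩_1 + ⟨a, ⟨b,c,d⟩_1, e⟩_1 − ⟨a, ⟨b,c,d⟩_1, e⟩_2 − ⟨d, ⟨b,c,a⟩_1, e⟩_2 + ⟨a, ⟨d,b,c⟩_2, e⟩_1 − ⟨a, ⟨d,b,c⟩_2, e⟩_2 − ⟨d, ⟨a,b,c⟩_2, e⟩_2 − ⟨b, c, ⟨a,d,e⟩_1⟩_1 − ⟨b, c, ⟨d,a,e⟩_1⟩_1 + ⟨d, a, ⟨b,c,e⟩_1⟩_2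 + ⟨b, c, ⟨a,d,e⟩_2⟩_1 = 0. -/
open DendriformDialgebra

set_option maxHeartbeats 4000000 in
theorem preJordan_triple_PJTS3
    {F : Type*} [Field F] [CharZero F] (A : DendriformDialgebra F)
    (a b c d e : A.carrier) :
    A.pjt1 (A.pjt1 b c d) a e + A.pjt1 (A.pjt2 d b c) a e
      + A.pjt1 a (A.pjt1 b c d) e - A.pjt2 a (A.pjt1 b c d) e
      - A.pjt2 d (A.pjt1 b c a) e + A.pjt1 a (A.pjt2 d b c) e
      - A.pjt2 a (A.pjt2 d b c) e - A.pjt2 d (A.pjt2 a b c) e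
      - A.pjt1 b c (A.pjt1 a d e) - A.pjt1 b c (A.pjt1 d a e)
      + A.pjt2 d a (A.pjt1 b c e) + A.pjt1 b c (A.pjt2 a d e) = 0 := by
  simp only [pjt1, pjt2, preJordan, map_add, LinearMap.add_apply, A.prec_prec, A.inner_assoc,
    A.succ_succ]
  abel
end

section
/- In every dendriform dialgebra D over a field of characteristic 0, the pre-Jordan triple products satisfy the identity PJTS_4 = 0: for all a, b, c, d, e ∈ D, ⟨a, ⟨b,c,d⟩_1, e⟩_2 + ⟨a, ⟨c,b,d⟩_1, e⟩_2 + ⟨a, ⟨d,b,c⟩_2, e⟩_2 + ⟨a, ⟨d,c,b⟩_2, e⟩_2 − ⟨a, b, ⟨c,d,e⟩_1⟩_2 − ⟨a, b, ⟨d,c,e⟩_1⟩_2 − ⟨a, c, ⟨b,d,e⟩_1⟩_2 − ⟨a, c, ⟨d,b,e⟩_1⟩_2 − ⟨a, d, ⟨b,c,e⟩_1⟩_2 − ⟨a, d, ⟨c,b,e⟩_1⟩_2 + ⟨a, b, ⟨d,c,e⟩_2⟩_2 + ⟨a, c, ⟨d,b,e⟩_2⟩_2 = 0. -/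
open DendriformDialgebra

theorem preJordan_triple_PJTS4
    {F : Type*} [Field F] [CharZero F] (A : DendriformDialgebra F)
    (a b c d e : A.carrier) :
    A.pjt2 a (A.pjt1 b c d) e + A.pjt2 a (A.pjt1 c b d) e
      + A.pjt2 a (A.pjt2 d b c) e + A.pjt2 a (A.pjt2 d c b) e
      - A.pjt2 a b (A.pjt1 c d e) - A.pjt2 a b (A.pjt1 d c e)
      - A.pjt2 a c (A.pjt1 b d e) - A.pjt2 a c (A.pjt1 d b e)
      - A.pjt2 a d (A.pjt1 b c e) - A.pjt2 a d (A.pjt1 c b e)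
      + A.pjt2 a b (A.pjt2 d c e) + A.pjt2 a c (A.pjt2 d b e) = 0 := by
  have key : A.preJordan (A.pjt1 b c d) e + A.preJordan (A.pjt1 c b d) e
      + A.preJordan (A.pjt2 d b c) e + A.preJordan (A.pjt2 d c b) e
      - A.preJordan b (A.pjt1 c d e) - A.preJordan b (A.pjt1 d c e)
      - A.preJordan c (A.pjt1 b d e) - A.preJordan c (A.pjt1 d b e)
      - A.preJordan d (A.pjt1 b c e) - A.preJordan d (A.pjt1 c b e)
      + A.preJordan b (A.pjt2 d c e) + A.preJordan c (A.pjt2 d b e) = 0 := by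
    simp only [pjt1, pjt2, preJordan, map_add, LinearMap.add_apply, A.prec_prec,
      A.inner_assoc, A.succ_succ]
    abel
  have h := congrArg (A.preJordan a) key
  simp only [preJordan, map_add, map_sub, LinearMap.add_apply, LinearMap.sub_apply,
    map_zero, LinearMap.zero_apply, add_zero] at h
  rw [← h]
  simp only [pjt2, preJordan, map_add, LinearMap.add_apply]
  abel
end

section
/- In every dendriform dialgebra D over a field of characteristic 0, the pre-Jordan triple products satisfy the identity PJTS_5 = 0: for all a, b, c, d, e ∈ D, ⟨⟨a,c,b⟩_1,d,e⟩_2 + ⟨⟨a,c,d⟩_1,b,e⟩_2 + ⟨⟨c,a,b⟩_1,d,e⟩_2 + ⟨⟨c,a,d⟩_1,b,e⟩_2 + ⟨⟨c,d,b⟩_1,a,e⟩_2 + ⟨⟨d,a,b⟩_1,c,e⟩_2 + ⟨⟨d,a,c⟩_1,b,e⟩_2 + ⟨⟨d,b,a⟩_1,c,e⟩_2 + ⟨⟨d,b,c⟩_1,a,e⟩_2 + ⟨⟨d,c,b⟩_1,a,e⟩_2 + ⟨⟨a,d,b⟩_2,c,e⟩_2 + ⟨⟨b,a,c⟩_2,d,e⟩_2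 + ⟨⟨b,c,a⟩_2,d,e⟩_2 + ⟨⟨b,c,d⟩_2,a,e⟩_2 + ⟨⟨b,d,a⟩_2,c,e⟩_2 + ⟨⟨b,d,c⟩_2,a,e⟩_2 + ⟨⟨c,d,a⟩_2,b,e⟩_2 + ⟨⟨c,d,b⟩_2,a,e⟩_2 + ⟨⟨d,a,c⟩_2,b,e⟩_2 + ⟨⟨d,c,a⟩_2,b,e⟩_2 − ⟨a,⟨b,c,d⟩_1,e⟩_1 − ⟨a,⟨b,d,c⟩_1,e⟩_1 − ⟨a,⟨c,b,d⟩_1,e⟩_1 − ⟨a,⟨c,d,b⟩_1,e⟩_1 − ⟨a,⟨d,b,c⟩_1,e⟩_1 − ⟨a,⟨d,c,b⟩_1,e⟩_1 − ⟨b,⟨a,c,d⟩_1,e⟩_1 − ⟨b,⟨a,d,c⟩_1,e⟩_1 − ⟨b,⟨c,a,d⟩_1,e⟩_1 − ⟨b,⟨c,d,a⟩_1,e⟩_1 − ⟨b,⟨d,a,c⟩_1,e⟩_1 − ⟨b,⟨d,c,a⟩_1,e⟩_1 − ⟨c,⟨a,b,d⟩_1,e⟩_1 − ⟨c,⟨a,d,b⟩_1,e⟩_1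 − ⟨c,⟨b,a,d⟩_1,e⟩_1 − ⟨c,⟨b,d,a⟩_1,e⟩_1 − ⟨c,⟨d,a,b⟩_1,e⟩_1 − ⟨c,⟨d,b,a⟩_1,e⟩_1 − ⟨d,⟨a,b,c⟩_1,e⟩_1 − ⟨d,⟨a,c,b⟩_1,e⟩_1 − ⟨d,⟨b,a,c⟩_1,e⟩_1 − ⟨d,⟨b,c,a⟩_1,e⟩_1 − ⟨d,⟨c,a,b⟩_1,e⟩_1 − ⟨d,⟨c,b,a⟩_1,e⟩_1 − ⟨a,⟨d,b,c⟩_1,e⟩_2 + ⟨b,⟨a,d,c⟩_1,e⟩_2 + ⟨c,⟨a,d,b⟩_1,e⟩_2 − ⟨c,⟨d,b,a⟩_1,e⟩_2 − ⟨a,⟨c,d,b⟩_2,e⟩_2 + ⟨b,⟨c,a,d⟩_2,e⟩_2 − ⟨c,⟨a,d,b⟩_2,e⟩_2 + ⟨c,⟨b,a,d⟩_2,e⟩_2 + ⟨a,b,⟨c,d,e⟩_1⟩_1 + ⟨a,b,⟨d,c,e⟩_1⟩_1 + ⟨a,c,⟨d,b,e⟩_1⟩_1 + ⟨a,d,⟨b,c,e⟩_1⟩_1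 + ⟨a,d,⟨c,b,e⟩_1⟩_1 + ⟨b,a,⟨c,d,e⟩_1⟩_1 + ⟨b,a,⟨d,c,e⟩_1⟩_1 + ⟨b,c,⟨d,a,e⟩_1⟩_1 + ⟨b,d,⟨a,c,e⟩_1⟩_1 + ⟨b,d,⟨c,a,e⟩_1⟩_1 + ⟨c,a,⟨d,b,e⟩_1⟩_1 + ⟨c,b,⟨d,a,e⟩_1⟩_1 − ⟨b,a,⟨c,d,e⟩_1⟩_2 − ⟨b,a,⟨d,c,e⟩_1⟩_2 − ⟨b,c,⟨a,d,e⟩_1⟩_2 − ⟨b,c,⟨d,a,e⟩_1⟩_2 − ⟨b,d,⟨a,c,e⟩_1⟩_2 − ⟨b,d,⟨c,a,e⟩_1⟩_2 − ⟨c,a,⟨d,b,e⟩_2⟩_2 − ⟨d,a,⟨c,b,e⟩_2⟩_2 = 0. -/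
open DendriformDialgebra

set_option maxHeartbeats 0 in
set_option maxRecDepth 100000 in
theorem preJordan_triple_PJTS5
    {F : Type*} [Field F] [CharZero F] (A : DendriformDialgebra F)
    (a b c d e : A.carrier) :
    A.pjt2 (A.pjt1 a c b) d e
      + A.pjt2 (A.pjt1 a c d) b e
      + A.pjt2 (A.pjt1 c a b) d e
      + A.pjt2 (A.pjt1 c a d) b e
      + A.pjt2 (A.pjt1 c d b) a e
      + A.pjt2 (A.pjt1 d a b) c e
      + A.pjt2 (A.pjt1 d a c) b e
      + A.pjt2 (A.pjt1 d b a) c e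
      + A.pjt2 (A.pjt1 d b c) a e
      + A.pjt2 (A.pjt1 d c b) a e
      + A.pjt2 (A.pjt2 a d b) c e
      + A.pjt2 (A.pjt2 b a c) d e
      + A.pjt2 (A.pjt2 b c a) d e
      + A.pjt2 (A.pjt2 b c d) a e
      + A.pjt2 (A.pjt2 b d a) c e
      + A.pjt2 (A.pjt2 b d c) a e
      + A.pjt2 (A.pjt2 c d a) b e
      + A.pjt2 (A.pjt2 c d b) a e
      + A.pjt2 (A.pjt2 d a c) b e
      + A.pjt2 (A.pjt2 d c a) b e
      - A.pjt1 a (A.pjt1 b c d) e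
      - A.pjt1 a (A.pjt1 b d c) e
      - A.pjt1 a (A.pjt1 c b d) e
      - A.pjt1 a (A.pjt1 c d b) e
      - A.pjt1 a (A.pjt1 d b c) e
      - A.pjt1 a (A.pjt1 d c b) e
      - A.pjt1 b (A.pjt1 a c d) e
      - A.pjt1 b (A.pjt1 a d c) e
      - A.pjt1 b (A.pjt1 c a d) e
      - A.pjt1 b (A.pjt1 c d a) e
      - A.pjt1 b (A.pjt1 d a c) e
      - A.pjt1 b (A.pjt1 d c a) e
      - A.pjt1 c (A.pjt1 a b d) e
      - A.pjt1 c (A.pjt1 a d b) e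
      - A.pjt1 c (A.pjt1 b a d) e
      - A.pjt1 c (A.pjt1 b d a) e
      - A.pjt1 c (A.pjt1 d a b) e
      - A.pjt1 c (A.pjt1 d b a) e
      - A.pjt1 d (A.pjt1 a b c) e
      - A.pjt1 d (A.pjt1 a c b) e
      - A.pjt1 d (A.pjt1 b a c) e
      - A.pjt1 d (A.pjt1 b c a) e
      - A.pjt1 d (A.pjt1 c a b) e
      - A.pjt1 d (A.pjt1 c b a) e
      - A.pjt2 a (A.pjt1 d b c) e
      + A.pjt2 b (A.pjt1 a d c) e
      + A.pjt2 c (A.pjt1 a d b) e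
      - A.pjt2 c (A.pjt1 d b a) e
      - A.pjt2 a (A.pjt2 c d b) e
      + A.pjt2 b (A.pjt2 c a d) e
      - A.pjt2 c (A.pjt2 a d b) e
      + A.pjt2 c (A.pjt2 b a d) e
      + A.pjt1 a b (A.pjt1 c d e)
      + A.pjt1 a b (A.pjt1 d c e)
      + A.pjt1 a c (A.pjt1 d b e)
      + A.pjt1 a d (A.pjt1 b c e)
      + A.pjt1 a d (A.pjt1 c b e)
      + A.pjt1 b a (A.pjt1 c d e)
      + A.pjt1 b a (A.pjt1 d c e)
      + A.pjt1 b c (A.pjt1 d a e)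
      + A.pjt1 b d (A.pjt1 a c e)
      + A.pjt1 b d (A.pjt1 c a e)
      + A.pjt1 c a (A.pjt1 d b e)
      + A.pjt1 c b (A.pjt1 d a e)
      - A.pjt2 b a (A.pjt1 c d e)
      - A.pjt2 b a (A.pjt1 d c e)
      - A.pjt2 b c (A.pjt1 a d e)
      - A.pjt2 b c (A.pjt1 d a e)
      - A.pjt2 b d (A.pjt1 a c e)
      - A.pjt2 b d (A.pjt1 c a e)
      - A.pjt2 c a (A.pjt2 d b e)
      - A.pjt2 d a (A.pjt2 c b e) = 0 := by
  simp only [pjt1, pjt2, preJordan, map_add, LinearMap.add_apply, A.prec_prec, A.inner_assoc, A.succ_succ]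
  abel
end
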